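/- Let n ≥ 1. For every continuous group homomorphism ψ from the group of invertible n×n matrices with entries in ℍ to ℂˣ there exists a unique s ∈ ℂ such that ψ(Q) = (det Φ(Q))^s for all invertible Q, where det Φ(Q) is a positive real number and r^s = exp(s · log r) for r a positive real. -/

import Mathlib

/-- The standard embedding of the quaternions into `2 × 2` complex matrices:
`a + b i + c j + d k` is sent to `[[a + b i, c + d i], [-c + d i, a - b i]]`. -/
noncomputable def quatToMatrix (q : Quaternion ℝ) : Matrix (Fin 2) (Fin 2) ℂ :=
  !![(⟨q.re, q.imI⟩ : ℂ), (⟨q.imJ, q.imK⟩ : ℂ);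
     (⟨-q.imJ, q.imK⟩ : ℂ), (⟨q.re, -q.imI⟩ : ℂ)]

/-- The block embedding of `n × n` quaternionic matrices into `2n × 2n` complex matrices,
whose `2 × 2` block at position `(s, t)` is `φ (Q s t)`. -/
noncomputable def quatMatrixToMatrix {n : ℕ} (Q : Matrix (Fin n) (Fin n) (Quaternion ℝ)) :
    Matrix (Fin n × Fin 2) (Fin n × Fin 2) ℂ :=
  fun p r => quatToMatrix (Q p.1 r.1) p.2 r.2

namespace Matrix

section Ring

variable {ι R : Type*} [Fintype ι] [DecidableEq ι] [Ring R]

/-- The invertible matrix `1 + c eₖᵀ`, for a column `c` with `c k = 0`. -/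
def columnShear (k : ι) (c : ι → R) (hc : c k = 0) : (Matrix ι ι R)ˣ where
  val := 1 + vecMulVec c (Pi.single k 1)
  inv := 1 - vecMulVec c (Pi.single k 1)
  val_inv := by
    have h : vecMulVec c (Pi.single k 1) * vecMulVec c (Pi.single k 1) = 0 := by
      simp [vecMulVec_mul_vecMulVec, hc]
    rw [add_mul, mul_sub, mul_sub, h]
    simp
  inv_val := by
    have h : vecMulVec c (Pi.single k 1) * vecMulVec c (Pi.single k 1) = 0 := by
      simp [vecMulVec_mul_vecMulVec, hc]
    rw [sub_mul, mul_add, mul_add, h]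
    simp

theorem columnShear_mul_apply (k : ι) (c : ι → R) (hc : c k = 0) (M : Matrix ι ι R) (i j : ι) :
    ((columnShear k c hc : Matrix ι ι R) * M) i j = M i j + c i * M k j := by
  simp [columnShear, add_mul, vecMulVec_mul, vecMulVec_apply]

/-- The diagonal matrix with the unit `x` at position `k` and `1` elsewhere. -/
def unitDiagonal (k : ι) : Rˣ →* (Matrix ι ι R)ˣ :=
  (Units.map (diagonalRingHom ι R).toMonoidHom).comp
    ((MulEquiv.piUnits (M := fun _ : ι => R)).symm.toMonoidHom.comp
      (MonoidHom.mulSingle (fun _ : ι => Rˣ) k))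

theorem coe_unitDiagonal (k : ι) (x : Rˣ) :
    (unitDiagonal k x : Matrix ι ι R) = diagonal (Pi.mulSingle k (x : R)) := by
  ext i j
  by_cases h : i = j
  · subst h
    by_cases hk : i = k
    · subst hk
      simp [unitDiagonal]
    · simp [unitDiagonal, hk]
  · simp [unitDiagonal, h]

theorem unitDiagonal_mul_apply (k : ι) (x : Rˣ) (M : Matrix ι ι R) (i j : ι) :
    ((unitDiagonal k x : Matrix ι ι R) * M) i j = if i = k then x * M k j else M i j := by
  rw [coe_unitDiagonal, diagonal_mul]
  split_ifs with h
  · subst h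
    simp
  · simp [h]

/-- The value of a commutative character on a diagonal matrix with a single nontrivial entry
does not depend on the position of this entry. -/
theorem map_unitDiagonal_eq {G : Type*} [CommGroup G] (f : (Matrix ι ι R)ˣ →* G)
    (i j : ι) (x : Rˣ) : f (unitDiagonal i x) = f (unitDiagonal j x) := by
  let w : (Matrix ι ι R)ˣ := ⟨swap R i j, swap R i j, swap_mul_self i j, swap_mul_self i j⟩
  have h : w * unitDiagonal i x = unitDiagonal j x * w := by
    ext a b
    simp only [Units.val_mul, w, unitDiagonal_mul_apply]
    by_cases hj : a = j
    · subst hj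
      rw [swap_mul_apply_right, if_pos rfl, coe_unitDiagonal, diagonal_apply,
        ← mul_one (swap R i a), swap_mul_apply_right, one_apply]
      split_ifs <;> simp
    · rw [if_neg hj]
      by_cases hi : a = i
      · subst hi
        rw [swap_mul_apply_left, coe_unitDiagonal, diagonal_apply,
          ← mul_one (swap R a j), swap_mul_apply_left, one_apply,
          Pi.mulSingle_eq_of_ne (Ne.symm hj)]
      · rw [swap_mul_of_ne hi hj, coe_unitDiagonal, diagonal_apply,
          ← mul_one (swap R i j), swap_mul_of_ne hi hj, one_apply,
          Pi.mulSingle_eq_of_ne hi]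
  have h' := congrArg f h
  rw [map_mul, map_mul, mul_comm] at h'
  exact mul_right_cancel h'

/-- A commutative character is trivial on column shears as soon as `2` is invertible. -/
theorem map_columnShear_eq_one {G : Type*} [CommGroup G] [Invertible (2 : R)]
    (f : (Matrix ι ι R)ˣ →* G) (k : ι) (c : ι → R) (hc : c k = 0) :
    f (columnShear k c hc) = 1 := by
  let d : (Matrix ι ι R)ˣ := unitDiagonal k (unitOfInvertible (2 : R))
  have h : columnShear k c hc * d = d * (columnShear k c hc * columnShear k c hc) := by
    ext a b
    simp only [Units.val_mul, d, unitDiagonal_mul_apply, columnShear_mul_apply]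
    rw [coe_unitDiagonal]
    by_cases ha : a = k
    · subst ha
      by_cases hb : a = b
      · subst hb
        simp [columnShear, vecMulVec_apply, hc]
      · simp [columnShear, vecMulVec_apply, hc, hb]
    · by_cases hb : k = b
      · subst hb
        simp [columnShear, vecMulVec_apply, hc, ha, mul_two]
      · simp [columnShear, vecMulVec_apply, hb, ha, Ne.symm hb,
          diagonal_apply, one_apply]
  have h' := congrArg f h
  rw [map_mul, map_mul, map_mul, mul_comm, mul_right_inj] at h'
  exact left_eq_mul.mp h'

end Ring

section DivisionRing

variable {ι K : Type*} [Fintype ι] [DecidableEq ι] [DivisionRing K]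

/-- If the columns of an invertible matrix indexed by `S` are standard basis vectors, then any
other column has a nonzero entry outside `S`. -/
theorem exists_notMem_apply_ne_zero {S : Finset ι} {k : ι} (hk : k ∉ S) (M : (Matrix ι ι K)ˣ)
    (hM : ∀ j ∈ S, ∀ i, (M : Matrix ι ι K) i j = (1 : Matrix ι ι K) i j) :
    ∃ i, i ∉ S ∧ (M : Matrix ι ι K) i k ≠ 0 := by
  by_contra! h
  let v : ι → K := fun j => (if j = k then 1 else 0) - (if j ∈ S then M.val j k else 0)
  have hv : M.val *ᵥ v = 0 := by
    ext i
    have h1 : ∀ j, M.val i j * (if j ∈ S then M.val j k else 0)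
        = if j = i then (if i ∈ S then M.val i k else 0) else 0 := by
      intro j
      by_cases hj : j ∈ S
      · rw [if_pos hj, hM j hj, one_apply]
        by_cases hij : i = j
        · subst hij
          simp [hj]
        · simp [hij, Ne.symm hij]
      · rw [if_neg hj, mul_zero]
        by_cases hij : j = i
        · subst hij
          simp [hj]
        · simp [hij]
    simp only [mulVec, dotProduct, v, mul_sub, Finset.sum_sub_distrib, h1]
    by_cases hi : i ∈ S
    · simp [hi]
    · simp [hi, h i hi]
  have hv0 : v = 0 := by
    rw [← one_mulVec v, ← M.inv_val, ← mulVec_mulVec, hv, mulVec_zero]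
  have := congrFun hv0 k
  simp [v, hk] at this

/-- Over a division ring, a subgroup of the general linear group which contains all column shears
and all diagonal matrices is the whole group. -/
theorem mem_of_columnShear_mem_of_unitDiagonal_mem (H : Subgroup (Matrix ι ι K)ˣ)
    (hs : ∀ k c hc, columnShear k c hc ∈ H) (hd : ∀ k x, unitDiagonal k x ∈ H)
    (Q : (Matrix ι ι K)ˣ) : Q ∈ H := by
  have key : ∀ S : Finset ι, ∃ h ∈ H, ∀ j ∈ S, ∀ i,
      ((h * Q : (Matrix ι ι K)ˣ) : Matrix ι ι K) i j = (1 : Matrix ι ι K) i j := by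
    intro S
    induction S using Finset.induction_on with
    | empty => exact ⟨1, H.one_mem, by simp⟩
    | insert k S hk ih =>
      obtain ⟨h₀, hh₀, h₀S⟩ := ih
      obtain ⟨h₁, hh₁, h₁S, h₁k⟩ : ∃ h ∈ H, (∀ j ∈ S, ∀ i,
          (h * Q).val i j = (1 : Matrix ι ι K) i j) ∧ (h * Q).val k k ≠ 0 := by
        by_cases h0 : (h₀ * Q).val k k = 0
        · obtain ⟨l, hl, hlk⟩ := exists_notMem_apply_ne_zero hk _ h₀S
          have hne : l ≠ k := by
            rintro rfl
            exact hlk h0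
          refine ⟨columnShear l (Pi.single k 1) (by simp [hne]) * h₀,
            H.mul_mem (hs _ _ _) hh₀, fun j hj i => ?_, ?_⟩
          · have hlj : l ≠ j := by
              rintro rfl
              exact hl hj
            rw [mul_assoc, Units.val_mul, columnShear_mul_apply, h₀S j hj, h₀S j hj,
              one_apply_ne hlj, mul_zero, add_zero]
          · rw [mul_assoc, Units.val_mul, columnShear_mul_apply, h0]
            simpa using hlk
        · exact ⟨h₀, hh₀, h₀S, h0⟩
      obtain ⟨h₂, hh₂, h₂S, h₂k⟩ : ∃ h ∈ H, (∀ j ∈ S, ∀ i,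
          (h * Q).val i j = (1 : Matrix ι ι K) i j) ∧ (h * Q).val k k = 1 := by
        refine ⟨unitDiagonal k (Units.mk0 _ h₁k)⁻¹ * h₁,
            H.mul_mem (hd _ _) hh₁, fun j hj i => ?_, ?_⟩
        · have hkj : k ≠ j := by
            rintro rfl
            exact hk hj
          rw [mul_assoc, Units.val_mul, unitDiagonal_mul_apply, h₁S j hj, h₁S j hj,
            one_apply_ne hkj, mul_zero]
          split_ifs with hik
          · rw [hik, one_apply_ne hkj]
          · rfl
        · rw [mul_assoc, Units.val_mul, unitDiagonal_mul_apply, if_pos rfl]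
          exact (Units.mk0 _ h₁k).inv_mul
      refine ⟨columnShear k (fun i => if i = k then 0 else -(h₂ * Q).val i k) (by simp) * h₂,
        H.mul_mem (hs _ _ _) hh₂, fun j hj i => ?_⟩
      rw [mul_assoc, Units.val_mul, columnShear_mul_apply]
      rcases Finset.mem_insert.mp hj with rfl | hj
      · rw [h₂k]
        by_cases hi : i = j
        · subst hi
          simp [h₂k]
        · simp [hi]
      · have hkj : k ≠ j := by
          rintro rfl
          exact hk hj
        rw [h₂S j hj, h₂S j hj, one_apply_ne hkj, mul_zero, add_zero]
  obtain ⟨h, hh, hQ⟩ := key Finset.univ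
  have h1 : h * Q = 1 := by
    ext i j
    exact hQ j (Finset.mem_univ j) i
  rw [eq_inv_of_mul_eq_one_right h1]
  exact H.inv_mem hh

end DivisionRing

end Matrix

namespace Quaternion

theorem exists_mul_eq_star_mul (q : Quaternion ℝ) :
    ∃ w : Quaternion ℝ, w ≠ 0 ∧ w * q = star q * w := by
  suffices h : ∃ x y : ℝ, (x ≠ 0 ∨ y ≠ 0) ∧ x * q.imI + y * q.imJ = 0 by
    obtain ⟨x, y, hxy, h⟩ := h
    obtain ⟨w, h0, h1, h2, h3⟩ : ∃ w : Quaternion ℝ,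
        w.re = 0 ∧ w.imI = x ∧ w.imJ = y ∧ w.imK = 0 := ⟨⟨0, x, y, 0⟩, rfl, rfl, rfl, rfl⟩
    refine ⟨w, ?_, ?_⟩
    · rintro rfl
      exact hxy.elim (fun hx => hx h1.symm) (fun hy => hy h2.symm)
    · ext <;> simp [h0, h1, h2, h3] <;> linarith
  by_cases h : q.imI = 0 ∧ q.imJ = 0
  · exact ⟨1, 0, by simp, by simp [h.1]⟩
  · exact ⟨q.imJ, -q.imI, by rw [neg_ne_zero]; tauto, by ring⟩

theorem exists_sq_eq (q : Quaternion ℝ) : ∃ p : Quaternion ℝ, p * p = q := by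
  have hn : ‖q‖ * ‖q‖ = q.re ^ 2 + q.imI ^ 2 + q.imJ ^ 2 + q.imK ^ 2 := by
    rw [← normSq_eq_norm_mul_self, normSq_def']
  have h0 := norm_nonneg q
  have hge : 0 ≤ ‖q‖ + q.re := by
    nlinarith [sq_nonneg q.imI, sq_nonneg q.imJ, sq_nonneg q.imK]
  rcases hge.eq_or_lt with hz | hpos
  · have hre : q.re = -‖q‖ := by linarith
    have hsum : q.imI ^ 2 + q.imJ ^ 2 + q.imK ^ 2 = 0 := by
      rw [hre] at hn
      linarith
    have hI : q.imI = 0 := by nlinarith [sq_nonneg q.imI, sq_nonneg q.imJ, sq_nonneg q.imK]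
    have hJ : q.imJ = 0 := by nlinarith [sq_nonneg q.imI, sq_nonneg q.imJ, sq_nonneg q.imK]
    have hK : q.imK = 0 := by nlinarith [sq_nonneg q.imI, sq_nonneg q.imJ, sq_nonneg q.imK]
    obtain ⟨p, p0, p1, p2, p3⟩ : ∃ p : Quaternion ℝ,
        p.re = 0 ∧ p.imI = √‖q‖ ∧ p.imJ = 0 ∧ p.imK = 0 := ⟨⟨0, √‖q‖, 0, 0⟩, rfl, rfl, rfl, rfl⟩
    refine ⟨p, ?_⟩
    ext <;> simp [hI, hJ, hK, hre, p0, p1, p2, p3]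
  · set r := ‖q‖ + q.re with hr
    have hs : √(2 * r) * √(2 * r) = 2 * r := Real.mul_self_sqrt (by positivity)
    have hs0 : √(2 * r) ≠ 0 := by positivity
    have hmul : (q + (‖q‖ : ℝ)) * (q + (‖q‖ : ℝ)) = (2 * r) • q := by
      ext <;> simp [hr] <;> linarith
    refine ⟨(√(2 * r))⁻¹ • (q + (‖q‖ : ℝ)), ?_⟩
    rw [smul_mul_smul_comm, hmul, smul_smul, ← mul_inv, hs, inv_mul_cancel₀ (by positivity),
      one_smul]

/-- The unit of the quaternions given by the positive real number `exp t`. -/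
noncomputable def expUnit (t : ℝ) : (Quaternion ℝ)ˣ where
  val := (Real.exp t : ℝ)
  inv := (Real.exp (-t) : ℝ)
  val_inv := by rw [← coe_mul, ← Real.exp_add]; simp
  inv_val := by rw [← coe_mul, ← Real.exp_add]; simp

theorem expUnit_add (t u : ℝ) : expUnit (t + u) = expUnit t * expUnit u := by
  ext1
  simp [expUnit, Real.exp_add]

/-- A commutative character of the unit group of the quaternions depends only on the norm. -/
theorem map_unit_eq_map_expUnit {G : Type*} [CommGroup G] (f : (Quaternion ℝ)ˣ →* G)
    (q : (Quaternion ℝ)ˣ) : f q = f (expUnit (Real.log ‖(q : Quaternion ℝ)‖)) := by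
  obtain ⟨p, hp⟩ := exists_sq_eq (q : Quaternion ℝ)
  have hp0 : p ≠ 0 := by
    rintro rfl
    exact q.ne_zero (by simpa using hp.symm)
  obtain ⟨w, hw0, hw⟩ := exists_mul_eq_star_mul p
  let p' : (Quaternion ℝ)ˣ := Units.mk0 p hp0
  let s : (Quaternion ℝ)ˣ := Units.mk0 (star p) (star_ne_zero.mpr hp0)
  have hq : q = p' * p' := Units.ext hp.symm
  have hws : Units.mk0 w hw0 * p' = s * Units.mk0 w hw0 := Units.ext hw
  have hfs : f p' = f s := by
    have := congrArg f hws
    rw [map_mul, map_mul, mul_comm] at this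
    exact mul_right_cancel this
  have hps : p' * s = expUnit (Real.log ‖(q : Quaternion ℝ)‖) := by
    ext1
    have : ‖(q : Quaternion ℝ)‖ = normSq p := by
      rw [← hp, norm_mul, normSq_eq_norm_mul_self]
    simp only [expUnit]
    rw [Real.exp_log (norm_pos_iff.mpr q.ne_zero), this]
    exact self_mul_star p
  rw [← hps, hq, map_mul, map_mul, hfs]

end Quaternion

/-- A continuous character of the additive group of the reals is an exponential. -/
theorem exists_eq_exp_of_continuous_of_map_add {g : ℝ → ℂ} (hg : Continuous g) (h0 : g 0 = 1)
    (hadd : ∀ t u, g (t + u) = g t * g u) : ∃ c : ℂ, ∀ t, g t = Complex.exp (c * t) := by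
  have hF : ∀ x, HasDerivAt (fun a => ∫ u in (0 : ℝ)..a, g u) (g x) x := fun x =>
    intervalIntegral.integral_hasDerivAt_right (hg.intervalIntegrable _ _)
      hg.stronglyMeasurable.stronglyMeasurableAtFilter hg.continuousAt
  obtain ⟨a, ha⟩ : ∃ a, ∫ u in (0 : ℝ)..a, g u ≠ 0 := by
    by_contra! h
    have h1 := hF 0
    simp only [h] at h1
    have := h1.unique (hasDerivAt_const (0 : ℝ) (0 : ℂ))
    simp [h0] at this
  have hint : ∀ t, g t = ((∫ u in (0 : ℝ)..(t + a), g u) - ∫ u in (0 : ℝ)..t, g u) /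
      ∫ u in (0 : ℝ)..a, g u := by
    intro t
    rw [eq_div_iff ha, intervalIntegral.integral_interval_sub_left (hg.intervalIntegrable _ _)
      (hg.intervalIntegrable _ _), ← intervalIntegral.integral_const_mul]
    simp_rw [← hadd]
    simp
  have hdiff : DifferentiableAt ℝ g 0 := by
    rw [funext hint]
    exact ((((hF (0 + a)).comp_add_const 0 a).sub (hF 0)).div_const _).differentiableAt
  have hderiv : ∀ t, HasDerivAt g (deriv g 0 * g t) t := by
    intro t
    have h1 : HasDerivAt (fun u => g (u - t) * g t) (deriv g 0 * g t) t := by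
      have h2 : HasDerivAt g (deriv g 0) (t - t) := by
        rw [sub_self]
        exact hdiff.hasDerivAt
      exact (h2.comp_sub_const t t).mul_const _
    refine h1.congr_of_eventuallyEq (Filter.Eventually.of_forall fun u => ?_)
    simp [← hadd]
  refine ⟨deriv g 0, fun t => ?_⟩
  have hexp : ∀ t : ℝ, HasDerivAt (fun u : ℝ => Complex.exp (-(deriv g 0 * u)))
      (Complex.exp (-(deriv g 0 * t)) * -(deriv g 0 * 1)) t := fun t =>
    (((hasDerivAt_id t).ofReal_comp.const_mul (deriv g 0)).neg).cexp
  have hconst : ∀ t : ℝ, HasDerivAt (fun u : ℝ => g u * Complex.exp (-(deriv g 0 * u))) 0 t := by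
    intro t
    refine ((hderiv t).mul (hexp t)).congr_deriv ?_
    ring
  have h1 := is_const_of_deriv_eq_zero (fun t => (hconst t).differentiableAt)
    (fun t => (hconst t).deriv) t 0
  simp only [h0, Complex.ofReal_zero, mul_zero, neg_zero, Complex.exp_zero, mul_one,
    Complex.exp_neg] at h1
  rwa [← div_eq_mul_inv, div_eq_one_iff_eq (Complex.exp_ne_zero _)] at h1

theorem quatToMatrix_mul (p q : Quaternion ℝ) :
    quatToMatrix (p * q) = quatToMatrix p * quatToMatrix q := by
  ext i j
  fin_cases i <;> fin_cases j <;>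
    simp [quatToMatrix, Matrix.mul_apply, Complex.ext_iff] <;> constructor <;> ring

theorem quatToMatrix_add (p q : Quaternion ℝ) :
    quatToMatrix (p + q) = quatToMatrix p + quatToMatrix q := by
  ext i j
  fin_cases i <;> fin_cases j <;> simp [quatToMatrix, Complex.ext_iff] <;> ring

theorem quatToMatrix_zero : quatToMatrix 0 = 0 := by
  simpa using quatToMatrix_add 0 0

theorem det_quatToMatrix (q : Quaternion ℝ) :
    (quatToMatrix q).det = ((‖q‖ ^ 2 : ℝ) : ℂ) := by
  rw [pow_two, ← Quaternion.normSq_eq_norm_mul_self, Quaternion.normSq_def']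
  simp only [quatToMatrix, Matrix.det_fin_two_of, Complex.ext_iff, Complex.sub_re, Complex.mul_re,
    Complex.sub_im, Complex.mul_im, Complex.ofReal_re, Complex.ofReal_im]
  constructor <;> ring

theorem quatMatrixToMatrix_mul {n : ℕ} (P Q : Matrix (Fin n) (Fin n) (Quaternion ℝ)) :
    quatMatrixToMatrix (P * Q) = quatMatrixToMatrix P * quatMatrixToMatrix Q := by
  let φ : Quaternion ℝ →+ Matrix (Fin 2) (Fin 2) ℂ :=
    ⟨⟨quatToMatrix, quatToMatrix_zero⟩, quatToMatrix_add⟩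
  ext ⟨a, i⟩ ⟨b, j⟩
  have h : quatToMatrix ((P * Q) a b) = ∑ c, quatToMatrix (P a c) * quatToMatrix (Q c b) := by
    rw [Matrix.mul_apply]
    exact (map_sum φ _ _).trans (Finset.sum_congr rfl fun c _ => quatToMatrix_mul _ _)
  rw [quatMatrixToMatrix, h, Matrix.sum_apply]
  simp only [quatMatrixToMatrix, Matrix.mul_apply, Fintype.sum_prod_type]

theorem det_quatMatrixToMatrix_diagonal {n : ℕ} (d : Fin n → Quaternion ℝ) :
    (quatMatrixToMatrix (Matrix.diagonal d)).det = ∏ k, ((‖d k‖ ^ 2 : ℝ) : ℂ) := by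
  have h : quatMatrixToMatrix (Matrix.diagonal d) =
      (Matrix.blockDiagonal fun k => quatToMatrix (d k)).submatrix
        (Equiv.prodComm _ _) (Equiv.prodComm _ _) := by
    ext ⟨a, i⟩ ⟨b, j⟩
    by_cases hab : a = b
    · subst hab
      simp [quatMatrixToMatrix]
    · simp [quatMatrixToMatrix, Matrix.blockDiagonal_apply, hab, quatToMatrix_zero]
  rw [h, Matrix.det_submatrix_equiv_self, Matrix.det_blockDiagonal]
  exact Finset.prod_congr rfl fun k _ => det_quatToMatrix _

/-- The reduced norm as a character of the general linear group of the quaternions. -/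
noncomputable def quatReducedNorm (n : ℕ) : (Matrix (Fin n) (Fin n) (Quaternion ℝ))ˣ →* ℂˣ :=
  Units.map
    { toFun := fun Q => (quatMatrixToMatrix Q).det
      map_one' := by
        rw [← Matrix.diagonal_one, det_quatMatrixToMatrix_diagonal]
        simp
      map_mul' := fun P Q => by rw [quatMatrixToMatrix_mul, Matrix.det_mul] }

theorem coe_quatReducedNorm {n : ℕ} (Q : (Matrix (Fin n) (Fin n) (Quaternion ℝ))ˣ) :
    (quatReducedNorm n Q : ℂ) = (quatMatrixToMatrix Q.val).det := rfl

theorem quatReducedNorm_unitDiagonal {n : ℕ} (k : Fin n) (x : (Quaternion ℝ)ˣ) :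
    (quatReducedNorm n (Matrix.unitDiagonal k x) : ℂ) =
      Complex.exp ((2 * Real.log ‖(x : Quaternion ℝ)‖ : ℝ) : ℂ) := by
  have hx : 0 < ‖(x : Quaternion ℝ)‖ := norm_pos_iff.mpr x.ne_zero
  rw [coe_quatReducedNorm, Matrix.coe_unitDiagonal, det_quatMatrixToMatrix_diagonal,
    Finset.prod_eq_single k (fun i _ hi => by simp [hi]) (by simp), Pi.mulSingle_eq_same,
    ← Complex.ofReal_exp, two_mul, Real.exp_add, Real.exp_log hx, pow_two]

theorem continuous_unitDiagonal_expUnit {n : ℕ} (k : Fin n) :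
    Continuous fun t : ℝ => Matrix.unitDiagonal k (Quaternion.expUnit t) := by
  have h : Continuous fun t : ℝ =>
      Matrix.diagonal (Pi.mulSingle k ((Real.exp t : ℝ) : Quaternion ℝ) :
        Fin n → Quaternion ℝ) := by
    refine Continuous.matrix_diagonal ((continuous_mulSingle k).comp ?_)
    exact Quaternion.continuous_coe.comp Real.continuous_exp
  rw [Units.continuous_iff]
  constructor
  · simp only [Function.comp_def, Matrix.coe_unitDiagonal]
    exact h
  · simp only [← map_inv, Matrix.coe_unitDiagonal]
    exact h.comp continuous_neg

set_option maxHeartbeats 1000000 in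
/-- **Characters of `GL(n, ℍ)` factor through the reduced norm** (Section 1.2 of the paper).
For `n ≥ 1`, every continuous group homomorphism `ψ` from `GL(n, ℍ)` to `ℂˣ` is of the form
`Q ↦ RN(Q) ^ s` for a unique `s ∈ ℂ`, where `RN(Q) = det Φ(Q)` is the reduced norm (a
positive real number) and `r ^ s = exp (s * log r)`. -/
theorem characters_of_GL_quaternion_factor_through_reduced_norm {n : ℕ} (hn : 1 ≤ n)
    (ψ : (Matrix (Fin n) (Fin n) (Quaternion ℝ))ˣ →* ℂˣ) (hψ : Continuous ψ) :
    ∃! s : ℂ, ∀ Q : (Matrix (Fin n) (Fin n) (Quaternion ℝ))ˣ,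
      (ψ Q : ℂ) = (quatMatrixToMatrix Q.val).det ^ s := by
  have cpow_eq : ∀ (t : ℝ) (s : ℂ), Complex.exp (t : ℂ) ^ s = Complex.exp (s * t) := by
    intro t s
    rw [Complex.cpow_def_of_ne_zero (Complex.exp_ne_zero _), ← Complex.ofReal_exp,
      ← Complex.ofReal_log (Real.exp_pos t).le, Real.log_exp, mul_comm]
  have : CharZero (Quaternion ℝ) := algebraRat.charZero _
  have : Invertible (2 : Quaternion ℝ) := invertibleOfNonzero two_ne_zero
  let k₀ : Fin n := ⟨0, hn⟩
  obtain ⟨c, hc⟩ := exists_eq_exp_of_continuous_of_map_add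
    (g := fun t => (ψ (Matrix.unitDiagonal k₀ (Quaternion.expUnit t)) : ℂ))
    (Units.continuous_val.comp (hψ.comp (continuous_unitDiagonal_expUnit k₀)))
    (by
      have h1 : Quaternion.expUnit 0 = 1 := by
        ext1
        simp [Quaternion.expUnit]
      simp [h1])
    (fun t u => by simp [Quaternion.expUnit_add])
  refine ⟨c / 2, fun Q => ?_, fun s hs => ?_⟩
  · let H : Subgroup (Matrix (Fin n) (Fin n) (Quaternion ℝ))ˣ :=
      { carrier := {Q | ∃ t : ℝ, (quatReducedNorm n Q : ℂ) = Complex.exp t ∧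
          (ψ Q : ℂ) = Complex.exp (c / 2 * t)}
        one_mem' := ⟨0, by simp⟩
        mul_mem' := by
          rintro P Q ⟨t, h1, h2⟩ ⟨u, h3, h4⟩
          refine ⟨t + u, ?_, ?_⟩
          · rw [map_mul, Units.val_mul, h1, h3, Complex.ofReal_add, Complex.exp_add]
          · rw [map_mul, Units.val_mul, h2, h4, Complex.ofReal_add, mul_add, Complex.exp_add]
        inv_mem' := by
          rintro P ⟨t, h1, h2⟩
          refine ⟨-t, ?_, ?_⟩
          · rw [map_inv, Units.val_inv_eq_inv_val, h1, Complex.ofReal_neg, Complex.exp_neg]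
          · rw [map_inv, Units.val_inv_eq_inv_val, h2, Complex.ofReal_neg, mul_neg,
              Complex.exp_neg] }
    obtain ⟨t, h1, h2⟩ : Q ∈ H := by
      refine Matrix.mem_of_columnShear_mem_of_unitDiagonal_mem H
        (fun k v hv => ⟨0, ?_, ?_⟩) (fun k x => ⟨_, quatReducedNorm_unitDiagonal k x, ?_⟩) Q
      · simp [Matrix.map_columnShear_eq_one]
      · simp [Matrix.map_columnShear_eq_one]
      · have h3 := Quaternion.map_unit_eq_map_expUnit (ψ.comp (Matrix.unitDiagonal k₀)) x
        simp only [MonoidHom.comp_apply] at h3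
        rw [Matrix.map_unitDiagonal_eq ψ k k₀, h3, hc]
        congr 1
        push_cast
        ring
    rw [h2, ← coe_quatReducedNorm, h1, cpow_eq]
  · have hexp : ∀ t : ℝ, Complex.exp (c * t) = Complex.exp (2 * s * t) := by
      intro t
      rw [← hc, hs, ← coe_quatReducedNorm, quatReducedNorm_unitDiagonal, cpow_eq]
      congr 1
      simp [Quaternion.expUnit]
      ring
    have hd : ∀ a : ℂ, HasDerivAt (fun t : ℝ => Complex.exp (a * t)) a 0 := by
      intro a
      simpa using ((hasDerivAt_id (0 : ℝ)).ofReal_comp.const_mul a).cexp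
    have h1 := hd c
    rw [funext hexp] at h1
    rw [h1.unique (hd (2 * s))]
    ring
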